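/- arXiv:1902.08931 — 2 statements merged into one kernel-verified Lean document; each statement's English description precedes it below -/
import Mathlib

section
/- Let p, q be integers, not both zero, set H := p² + q², and define V : ℝ → ℝ² by V(t) = (1/H)·(−q·cos(H·t) − 2π·p·sin(H·t), −q·sin(H·t) + 2π·p·cos(H·t)). Then for every t ∈ ℝ, det(V(t), V'(t)) = H·‖V(t)‖², where for u, v ∈ ℝ² one sets det(u, v) := u₁·v₂ − u₂·v₁ and V' denotes the derivative of V with respect to t. -/
open Real

/-- A curve in the plane that rotates with angular velocity `ω` has as derivative `ω` times the
quarter turn of its position. -/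
theorem hasDerivAt_rotating_curve (c a b ω t : ℝ) :
    HasDerivAt (fun s : ℝ ↦ (WithLp.equiv 2 (Fin 2 → ℝ)).symm
        ![c * (a * Real.cos (ω * s) - b * Real.sin (ω * s)),
          c * (a * Real.sin (ω * s) + b * Real.cos (ω * s))])
      ((WithLp.equiv 2 (Fin 2 → ℝ)).symm
        ![-(ω * (c * (a * Real.sin (ω * t) + b * Real.cos (ω * t)))),
          ω * (c * (a * Real.cos (ω * t) - b * Real.sin (ω * t)))]) t := by
  have hω : HasDerivAt (fun s : ℝ ↦ ω * s) ω t := by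
    simpa using (hasDerivAt_id t).const_mul ω
  rw [hasDerivAt_iff_hasFDerivAt, ← hasFDerivWithinAt_univ, hasFDerivWithinAt_euclidean]
  intro i
  rw [hasFDerivWithinAt_univ, hasFDerivAt_iff_hasDerivAt]
  fin_cases i
  · refine (((hω.cos.const_mul a).sub (hω.sin.const_mul b)).const_mul c).congr_deriv ?_
    simp
    ring
  · refine (((hω.sin.const_mul a).add (hω.cos.const_mul b)).const_mul c).congr_deriv ?_
    simp
    ring

/-- For the push-forward `V(t)` of `∂/∂x` along the type-`(p,q)` curve, one has
`det(V(t), V'(t)) = H·‖V(t)‖²` for every `t`, where `H = p² + q²` and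
`det(u, v) = u₁·v₂ − u₂·v₁`. -/
theorem det_V_derivV_eq_H_mul_norm_sq (p q : ℤ) (hpq : ¬(p = 0 ∧ q = 0))
    (V : ℝ → EuclideanSpace ℝ (Fin 2))
    (hV : ∀ t : ℝ, V t = (WithLp.equiv 2 (Fin 2 → ℝ)).symm
      ![(1 / ((p : ℝ) ^ 2 + (q : ℝ) ^ 2)) *
          (-(q : ℝ) * Real.cos (((p : ℝ) ^ 2 + (q : ℝ) ^ 2) * t)
            - 2 * π * (p : ℝ) * Real.sin (((p : ℝ) ^ 2 + (q : ℝ) ^ 2) * t)),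
        (1 / ((p : ℝ) ^ 2 + (q : ℝ) ^ 2)) *
          (-(q : ℝ) * Real.sin (((p : ℝ) ^ 2 + (q : ℝ) ^ 2) * t)
            + 2 * π * (p : ℝ) * Real.cos (((p : ℝ) ^ 2 + (q : ℝ) ^ 2) * t))]) :
    ∀ t : ℝ,
      V t 0 * deriv V t 1 - V t 1 * deriv V t 0
        = ((p : ℝ) ^ 2 + (q : ℝ) ^ 2) * ‖V t‖ ^ 2 := by
  intro t
  have hV' := hasDerivAt_rotating_curve (1 / ((p : ℝ) ^ 2 + (q : ℝ) ^ 2)) (-(q : ℝ))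
    (2 * π * (p : ℝ)) ((p : ℝ) ^ 2 + (q : ℝ) ^ 2) t
  rw [← funext hV] at hV'
  rw [hV'.deriv, EuclideanSpace.real_norm_sq_eq, Fin.sum_univ_two, hV t]
  simp only [WithLp.equiv_symm_apply, Matrix.cons_val_zero, Matrix.cons_val_one]
  ring
end

section
/- Let p, q be integers, not both zero, and set H := p² + q². Define V : ℝ → ℝ² by V(t) = (1/H)·(−q·cos(H·t) − 2π·p·sin(H·t), −q·sin(H·t) + 2π·p·cos(H·t)). Then (1/(2π)) · ∫₀^{2π} det(V(t), V'(t))/‖V(t)‖² dt = H = p² + q², where det(u, v) := u₁·v₂ − u₂·v₁. In particular this index equals 1 exactly when p² + q² = 1. -/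
open Real

/-- Derivative of a planar vector `(a, b)` rotating with angular velocity `H`. -/
theorem hasDerivAt_rotating_vector (a b H t : ℝ) :
    HasDerivAt
      (fun s ↦ !₂[a * cos (H * s) - b * sin (H * s), a * sin (H * s) + b * cos (H * s)])
      (!₂[-(H * (a * sin (H * t) + b * cos (H * t))),
        H * (a * cos (H * t) - b * sin (H * t))]) t := by
  have hlin : HasDerivAt (fun s ↦ H * s) H t := by
    simpa using (hasDerivAt_id t).const_mul H
  have hcos := hlin.cos
  have hsin := hlin.sin
  have hpi : HasDerivAt
      (fun s ↦ ![a * cos (H * s) - b * sin (H * s), a * sin (H * s) + b * cos (H * s)])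
      ![-(H * (a * sin (H * t) + b * cos (H * t))),
        H * (a * cos (H * t) - b * sin (H * t))] t := by
    rw [hasDerivAt_pi]
    intro i
    fin_cases i
    · exact ((hcos.const_mul a).sub (hsin.const_mul b)).congr_deriv (by simp; ring)
    · exact ((hsin.const_mul a).add (hcos.const_mul b)).congr_deriv (by simp; ring)
  exact (PiLp.hasFDerivAt_toLp (𝕜 := ℝ) 2 _).comp_hasDerivAt t hpi

/-- A nonzero planar vector rotating with angular velocity `H` has angular speed `H`, computed as
`det (V, V') / ‖V‖ ^ 2`. -/
theorem det_deriv_div_norm_sq_of_rotating {a b H : ℝ} (hab : a ^ 2 + b ^ 2 ≠ 0)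
    {V : ℝ → EuclideanSpace ℝ (Fin 2)}
    (hV : ∀ t, V t =
      !₂[a * cos (H * t) - b * sin (H * t), a * sin (H * t) + b * cos (H * t)]) (t : ℝ) :
    (V t 0 * deriv V t 1 - V t 1 * deriv V t 0) / ‖V t‖ ^ 2 = H := by
  have hderiv := (hasDerivAt_rotating_vector a b H t).deriv
  rw [← funext hV] at hderiv
  have hnorm : ‖V t‖ ^ 2 = a ^ 2 + b ^ 2 := by
    rw [EuclideanSpace.real_norm_sq_eq, Fin.sum_univ_two, hV]
    simp only [Matrix.cons_val_zero, Matrix.cons_val_one]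
    linear_combination (a ^ 2 + b ^ 2) * sin_sq_add_cos_sq (H * t)
  rw [hnorm, hderiv, hV, div_eq_iff hab]
  simp only [Matrix.cons_val_zero, Matrix.cons_val_one]
  linear_combination H * (a ^ 2 + b ^ 2) * sin_sq_add_cos_sq (H * t)

/-- The index integral of the push-forward `V(t)` of `∂/∂x` along the
type-`(p,q)` curve equals `H = p² + q²`:
`(1/2π)·∫₀^{2π} det(V, V')/‖V‖² dt = p² + q²`; in particular it equals `1`
exactly when `p² + q² = 1`. -/
theorem index_integral_eq_H (p q : ℤ) (hpq : ¬(p = 0 ∧ q = 0))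
    (V : ℝ → EuclideanSpace ℝ (Fin 2))
    (hV : ∀ t : ℝ, V t = (WithLp.equiv 2 (Fin 2 → ℝ)).symm
      ![(1 / ((p : ℝ) ^ 2 + (q : ℝ) ^ 2)) *
          (-(q : ℝ) * Real.cos (((p : ℝ) ^ 2 + (q : ℝ) ^ 2) * t)
            - 2 * π * (p : ℝ) * Real.sin (((p : ℝ) ^ 2 + (q : ℝ) ^ 2) * t)),
        (1 / ((p : ℝ) ^ 2 + (q : ℝ) ^ 2)) *
          (-(q : ℝ) * Real.sin (((p : ℝ) ^ 2 + (q : ℝ) ^ 2) * t)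
            + 2 * π * (p : ℝ) * Real.cos (((p : ℝ) ^ 2 + (q : ℝ) ^ 2) * t))]) :
    (1 / (2 * π)) *
        ∫ t in (0 : ℝ)..(2 * π),
          (V t 0 * deriv V t 1 - V t 1 * deriv V t 0) / ‖V t‖ ^ 2
      = (p : ℝ) ^ 2 + (q : ℝ) ^ 2 ∧
    ((1 / (2 * π)) *
        ∫ t in (0 : ℝ)..(2 * π),
          (V t 0 * deriv V t 1 - V t 1 * deriv V t 0) / ‖V t‖ ^ 2
      = 1 ↔ (p : ℝ) ^ 2 + (q : ℝ) ^ 2 = 1) := by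
  set H : ℝ := (p : ℝ) ^ 2 + (q : ℝ) ^ 2 with hH
  have hpq' : (p : ℝ) ≠ 0 ∨ (q : ℝ) ≠ 0 := by
    simpa only [ne_eq, Int.cast_eq_zero] using not_and_or.mp hpq
  have hH0 : 0 < H := by
    rcases hpq' with h | h <;> positivity
  have hab : (-(q : ℝ) / H) ^ 2 + (2 * π * p / H) ^ 2 ≠ 0 := by
    apply ne_of_gt
    rw [neg_div, neg_sq]
    rcases hpq' with h | h <;> positivity
  have hrot (t : ℝ) : V t =
      !₂[-(q : ℝ) / H * cos (H * t) - 2 * π * p / H * sin (H * t),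
        -(q : ℝ) / H * sin (H * t) + 2 * π * p / H * cos (H * t)] := by
    rw [hV]
    ext i
    fin_cases i <;> simp <;> ring
  have hindex : (1 / (2 * π)) * ∫ t in (0 : ℝ)..(2 * π),
      (V t 0 * deriv V t 1 - V t 1 * deriv V t 0) / ‖V t‖ ^ 2 = H := by
    simp_rw [det_deriv_div_norm_sq_of_rotating hab hrot]
    rw [intervalIntegral.integral_const, smul_eq_mul]
    field_simp
    ring
  exact ⟨hindex, by rw [hindex]⟩
end
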